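/- Let S be a regular ordered semigroup. Then a nonempty subset B ⊆ S is a bi-ideal of S if and only if there exist a right ideal R of S and a left ideal L of S such that B = (RL]. -/

import Mathlib

variable {S : Type*}

/-- Downward closure `(A] = {x | ∃ a ∈ A, x ≤ a}`. -/
def dcl [LE S] (A : Set S) : Set S := {x | ∃ a ∈ A, x ≤ a}

/-- Product of subsets `UV = {u·v | u ∈ U, v ∈ V}`. -/
def setMul [Mul S] (A B : Set S) : Set S := {x | ∃ a ∈ A, ∃ b ∈ B, x = a * b}

/-- Compatibility of the order with multiplication (ordered semigroup axiom). -/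
def OrdCompat (S : Type*) [Mul S] [LE S] : Prop :=
  ∀ x a b : S, a ≤ b → x * a ≤ x * b ∧ a * x ≤ b * x

/-- A bi-ideal: nonempty, `A·S·A ⊆ A`, and `(A] = A`. -/
def IsBiIdeal [Semigroup S] [LE S] (A : Set S) : Prop :=
  A.Nonempty ∧ (∀ a ∈ A, ∀ s : S, ∀ b ∈ A, a * s * b ∈ A) ∧ dcl A = A

/-- A right ideal: nonempty, `R·S ⊆ R`, `(R] = R`. -/
def IsRightIdeal [Semigroup S] [LE S] (R : Set S) : Prop :=
  R.Nonempty ∧ (∀ r ∈ R, ∀ s : S, r * s ∈ R) ∧ dcl R = R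

/-- A left ideal: nonempty, `S·L ⊆ L`, `(L] = L`. -/
def IsLeftIdeal [Semigroup S] [LE S] (L : Set S) : Prop :=
  L.Nonempty ∧ (∀ l ∈ L, ∀ s : S, s * l ∈ L) ∧ dcl L = L

/-- Principal left ideal `L(a) = ({a} ∪ Sa]`. -/
def Lp [Semigroup S] [LE S] (a : S) : Set S :=
  dcl (({a} : Set S) ∪ Set.range (fun s => s * a))

/-- Principal right ideal `R(a) = ({a} ∪ aS]`. -/
def Rp [Semigroup S] [LE S] (a : S) : Set S :=
  dcl (({a} : Set S) ∪ Set.range (fun s => a * s))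

theorem dcl_dcl [Preorder S] (A : Set S) : dcl (dcl A) = dcl A := by
  ext x
  constructor
  · rintro ⟨y, ⟨a, ha, hya⟩, hxy⟩
    exact ⟨a, ha, hxy.trans hya⟩
  · intro hx
    exact ⟨x, hx, le_rfl⟩

theorem OrdCompat.mul_le_mul [Mul S] [Preorder S] (h : OrdCompat S) {a b c d : S}
    (hab : a ≤ b) (hcd : c ≤ d) : a * c ≤ b * d :=
  ((h c a b hab).2).trans (h b c d hcd).1

theorem isRightIdeal_dcl_setMul_univ [Semigroup S] [Preorder S] (h : OrdCompat S)
    {B : Set S} (hB : B.Nonempty) : IsRightIdeal (dcl (setMul B Set.univ)) := by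
  obtain ⟨b, hb⟩ := hB
  refine ⟨⟨b * b, b * b, ⟨b, hb, b, trivial, rfl⟩, le_rfl⟩, ?_, dcl_dcl _⟩
  rintro r ⟨_, ⟨c, hc, t, -, rfl⟩, hr⟩ s
  exact ⟨c * (t * s), ⟨c, hc, t * s, trivial, rfl⟩,
    (h.mul_le_mul hr le_rfl).trans_eq (mul_assoc c t s)⟩

theorem isLeftIdeal_dcl_univ_setMul [Semigroup S] [Preorder S] (h : OrdCompat S)
    {B : Set S} (hB : B.Nonempty) : IsLeftIdeal (dcl (setMul Set.univ B)) := by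
  obtain ⟨b, hb⟩ := hB
  refine ⟨⟨b * b, b * b, ⟨b, trivial, b, hb, rfl⟩, le_rfl⟩, ?_, dcl_dcl _⟩
  rintro l ⟨_, ⟨t, -, c, hc, rfl⟩, hl⟩ s
  exact ⟨s * t * c, ⟨s * t, trivial, c, hc, rfl⟩,
    (h.mul_le_mul le_rfl hl).trans_eq (mul_assoc s t c).symm⟩

theorem IsBiIdeal.eq_dcl_setMul [Semigroup S] [Preorder S] (h : OrdCompat S)
    (hreg : ∀ a : S, ∃ x : S, a ≤ a * x * a) {B : Set S} (hB : IsBiIdeal B) :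
    B = dcl (setMul (dcl (setMul B Set.univ)) (dcl (setMul Set.univ B))) := by
  obtain ⟨-, hmul, hdcl⟩ := hB
  ext b
  constructor
  · intro hb
    obtain ⟨x, hx⟩ := hreg b
    exact ⟨b * x * b, ⟨b * x, ⟨b * x, ⟨b, hb, x, trivial, rfl⟩, le_rfl⟩, b,
      ⟨b * x * b, ⟨b * x, trivial, b, hb, rfl⟩, hx⟩, rfl⟩, hx⟩
  · rintro ⟨_, ⟨r, ⟨_, ⟨c, hc, s, -, rfl⟩, hr⟩, l, ⟨_, ⟨t, -, d, hd, rfl⟩, hl⟩, rfl⟩, hb⟩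
    rw [← hdcl]
    refine ⟨c * (s * t) * d, hmul c hc _ d hd, hb.trans ((h.mul_le_mul hr hl).trans_eq ?_)⟩
    simp only [mul_assoc]

theorem isBiIdeal_dcl_setMul [Semigroup S] [Preorder S] (h : OrdCompat S) {R L : Set S}
    (hR : IsRightIdeal R) (hL : IsLeftIdeal L) : IsBiIdeal (dcl (setMul R L)) := by
  obtain ⟨⟨r₀, hr₀⟩, hRmul, -⟩ := hR
  obtain ⟨l₀, hl₀⟩ := hL.1
  refine ⟨⟨r₀ * l₀, r₀ * l₀, ⟨r₀, hr₀, l₀, hl₀, rfl⟩, le_rfl⟩, ?_, dcl_dcl _⟩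
  rintro a ⟨_, ⟨r, hr, l, -, rfl⟩, ha⟩ s b ⟨_, ⟨r', -, l', hl', rfl⟩, hb⟩
  refine ⟨r * (l * s * r') * l', ⟨_, hRmul r hr _, l', hl', rfl⟩,
    (h.mul_le_mul (h.mul_le_mul ha le_rfl) hb).trans_eq ?_⟩
  simp only [mul_assoc]

theorem stmt_10 [Semigroup S] [PartialOrder S] (hcomp : OrdCompat S)
    (hreg : ∀ a : S, ∃ x : S, a ≤ a * x * a)
    (B : Set S) (hB : B.Nonempty) :
    IsBiIdeal B ↔ ∃ R L : Set S, IsRightIdeal R ∧ IsLeftIdeal L ∧ B = dcl (setMul R L) := by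
  constructor
  · intro hbi
    exact ⟨_, _, isRightIdeal_dcl_setMul_univ hcomp hB, isLeftIdeal_dcl_univ_setMul hcomp hB,
      hbi.eq_dcl_setMul hcomp hreg⟩
  · rintro ⟨R, L, hR, hL, rfl⟩
    exact isBiIdeal_dcl_setMul hcomp hR hL
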